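/- Let A ∈ ℤ^{m×n}, b ∈ ℤ^m, and P = conv{x ∈ ℕ^n : Ax = b}. Let w ∈ ℝ^n be a linear functional whose set of maximizers over P is an edge e of P (a one-dimensional face), and let u, v ∈ e ∩ ℤ^n be distinct. Then u − v is a positive integer multiple of a single element of the Graver basis G(A). -/

import Mathlib

open Matrix

noncomputable section

/-- Coordinatewise cast of an integer vector to a real vector. -/
def intCast {n : ℕ} (z : Fin n → ℤ) : Fin n → ℝ := fun i => (z i : ℝ)

/-- The set of nonnegative integer solutions of `Ax = b`, viewed inside `ℝ^n`. -/
def feasSet {m n : ℕ} (A : Matrix (Fin m) (Fin n) ℤ) (b : Fin m → ℤ) : Set (Fin n → ℝ) :=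
  {x | ∃ y : Fin n → ℕ, x = (fun i => ((y i : ℝ))) ∧ A.mulVec (fun i => ((y i : ℤ))) = b}

/-- The conformal order `u ⊑ v` on `ℤ^n`. -/
def ConformalTo {n : ℕ} (u v : Fin n → ℤ) : Prop :=
  ∀ i, 0 ≤ u i * v i ∧ |u i| ≤ |v i|

/-- The Graver basis of `A`: the `⊑`-minimal elements of `{x ∈ ℤ^n : Ax = 0} \ {0}`. -/
def GraverBasis {m n : ℕ} (A : Matrix (Fin m) (Fin n) ℤ) : Set (Fin n → ℤ) :=
  {g | g ≠ 0 ∧ A.mulVec g = 0 ∧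
    ∀ h : Fin n → ℤ, h ≠ 0 → A.mulVec h = 0 → ConformalTo h g → h = g}

theorem ConformalTo.trans {n : ℕ} {u v w : Fin n → ℤ} (huv : ConformalTo u v)
    (hvw : ConformalTo v w) : ConformalTo u w := by
  intro i
  obtain ⟨h₁, h₂⟩ := huv i
  obtain ⟨h₃, h₄⟩ := hvw i
  refine ⟨?_, h₂.trans h₄⟩
  rcases eq_or_ne (v i) 0 with hv | hv
  · have hu : u i = 0 := by simpa [hv] using h₂
    simp [hu]
  · have hpos : 0 < v i * v i := mul_self_pos.mpr hv
    refine nonneg_of_mul_nonneg_left (b := v i * v i) ?_ hpos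
    nlinarith [mul_nonneg h₁ h₃]

theorem conformalTo_of_eq_mul {n : ℕ} {h d : Fin n → ℤ} {c : ℝ} (hc₀ : 0 ≤ c) (hc₁ : c ≤ 1)
    (hcd : ∀ i, (h i : ℝ) = c * d i) : ConformalTo h d := by
  intro i
  constructor
  · have : (0 : ℝ) ≤ h i * d i := by
      rw [hcd, mul_assoc]
      exact mul_nonneg hc₀ (mul_self_nonneg _)
    exact_mod_cast this
  · have : |(h i : ℝ)| ≤ |(d i : ℝ)| := by
      rw [hcd, abs_mul, abs_of_nonneg hc₀]
      exact mul_le_of_le_one_left (abs_nonneg _) hc₁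
    exact_mod_cast this

theorem intCast_mem_feasSet_iff {m n : ℕ} {A : Matrix (Fin m) (Fin n) ℤ} {b : Fin m → ℤ}
    {z : Fin n → ℤ} : intCast z ∈ feasSet A b ↔ 0 ≤ z ∧ A.mulVec z = b := by
  constructor
  · rintro ⟨y, hy, hA⟩
    have hz : z = fun i => (y i : ℤ) := by
      funext i
      have := congrFun hy i
      simp only [intCast] at this
      exact_mod_cast this
    subst hz
    exact ⟨fun i => Int.natCast_nonneg _, hA⟩
  · rintro ⟨hz, hA⟩
    have hy : (fun i => ((z i).toNat : ℤ)) = z := funext fun i => Int.toNat_of_nonneg (hz i)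
    refine ⟨fun i => (z i).toNat, ?_, by rw [hy, hA]⟩
    funext i
    have := congrFun hy i
    simp only [intCast]
    exact_mod_cast this.symm

theorem map_mulVec_intCast {m n : ℕ} (A : Matrix (Fin m) (Fin n) ℤ) (z : Fin n → ℤ) :
    (A.map (Int.cast : ℤ → ℝ)).mulVec (intCast z) = intCast (A.mulVec z) := by
  funext i
  simp [intCast, Matrix.mulVec, dotProduct]

/-- The integer points of the convex hull of the feasible points are feasible. -/
theorem intCast_mem_convexHull_feasSet_iff {m n : ℕ} {A : Matrix (Fin m) (Fin n) ℤ}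
    {b : Fin m → ℤ} {z : Fin n → ℤ} :
    intCast z ∈ convexHull ℝ (feasSet A b) ↔ 0 ≤ z ∧ A.mulVec z = b := by
  refine ⟨fun hz => ?_, fun hz => subset_convexHull ℝ _ (intCast_mem_feasSet_iff.mpr hz)⟩
  have hconv : Convex ℝ {x : Fin n → ℝ | 0 ≤ x ∧
      (A.map (Int.cast : ℤ → ℝ)).mulVec x = intCast b} := by
    rintro x ⟨hx₀, hx⟩ y ⟨hy₀, hy⟩ s t hs ht hst
    refine ⟨add_nonneg (smul_nonneg hs hx₀) (smul_nonneg ht hy₀), ?_⟩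
    rw [Matrix.mulVec_add, Matrix.mulVec_smul, Matrix.mulVec_smul, hx, hy, ← add_smul, hst,
      one_smul]
  have hsub : feasSet A b ⊆ {x : Fin n → ℝ | 0 ≤ x ∧
      (A.map (Int.cast : ℤ → ℝ)).mulVec x = intCast b} := by
    rintro x ⟨y, rfl, hA⟩
    refine ⟨fun i => Nat.cast_nonneg _, ?_⟩
    rw [← hA, ← map_mulVec_intCast]
    congr 1
  obtain ⟨h₀, hA⟩ := convexHull_min hsub hconv hz
  refine ⟨fun i => ?_, ?_⟩
  · have := h₀ i
    simp only [intCast, Pi.zero_apply] at this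
    exact_mod_cast this
  · rw [map_mulVec_intCast] at hA
    funext i
    have := congrFun hA i
    simp only [intCast] at this
    exact_mod_cast this

/-- If every kernel vector conformal to `d` is a real multiple of `d`, then `d` is a positive
integer multiple of a Graver basis element. -/
theorem exists_graverBasis_smul_eq {m n : ℕ} {A : Matrix (Fin m) (Fin n) ℤ} {d : Fin n → ℤ}
    (hd : d ≠ 0) (hAd : A.mulVec d = 0)
    (hline : ∀ h : Fin n → ℤ, A.mulVec h = 0 → ConformalTo h d →
      ∃ c : ℝ, ∀ i, (h i : ℝ) = c * d i) :
    ∃ g ∈ GraverBasis A, ∃ k : ℕ, 0 < k ∧ d = (k : ℤ) • g := by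
  obtain ⟨i, hi⟩ := Function.ne_iff.mp hd
  have hiR : (d i : ℝ) ≠ 0 := by exact_mod_cast hi
  have hdi : 0 < |(d i : ℝ)| := abs_pos.mpr hiR
  have hline' : ∀ h : Fin n → ℤ, h ≠ 0 → A.mulVec h = 0 → ConformalTo h d →
      ∃ c : ℝ, 0 < c ∧ c ≤ 1 ∧ ∀ j, (h j : ℝ) = c * d j := by
    intro h hne hA hconf
    obtain ⟨c, hc⟩ := hline h hA hconf
    obtain ⟨h₁, h₂⟩ := hconf i
    have h₁' : (0 : ℝ) ≤ h i * d i := by exact_mod_cast h₁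
    have h₂' : |(h i : ℝ)| ≤ |(d i : ℝ)| := by exact_mod_cast h₂
    have hc0 : c ≠ 0 := by
      rintro rfl
      refine hne (funext fun j => ?_)
      have := hc j
      rw [zero_mul] at this
      exact_mod_cast this
    rw [hc, mul_assoc] at h₁'
    rw [hc, abs_mul] at h₂'
    have hcnn : 0 ≤ c := nonneg_of_mul_nonneg_left h₁' (mul_self_pos.mpr hiR)
    refine ⟨c, lt_of_le_of_ne hcnn hc0.symm, ?_, hc⟩
    rw [abs_of_nonneg hcnn] at h₂'
    exact (mul_le_iff_le_one_left hdi).mp h₂'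
  obtain ⟨g, ⟨hg, hAg, hgd⟩, hmin⟩ := exists_minimalFor_of_wellFoundedLT
    (fun h : Fin n → ℤ => h ≠ 0 ∧ A.mulVec h = 0 ∧ ConformalTo h d) (fun h => (h i).natAbs)
    ⟨d, hd, hAd, fun j => ⟨mul_self_nonneg _, le_rfl⟩⟩
  obtain ⟨c, hc, hc₁, hcg⟩ := hline' g hg hAg hgd
  have hle : ∀ h : Fin n → ℤ, h ≠ 0 → A.mulVec h = 0 → ConformalTo h d → ∀ s : ℝ, 0 ≤ s →
      (∀ j, (h j : ℝ) = s * d j) → c ≤ s := by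
    intro h hne hA hconf s hs hh
    have hnat : (g i).natAbs ≤ (h i).natAbs :=
      (le_total (h i).natAbs (g i).natAbs).elim (fun hle => hmin ⟨hne, hA, hconf⟩ hle) id
    have habs : |(g i : ℝ)| ≤ |(h i : ℝ)| := by
      have : |g i| ≤ |h i| := by
        rw [Int.abs_eq_natAbs, Int.abs_eq_natAbs]
        exact_mod_cast hnat
      exact_mod_cast this
    rw [hcg, hh, abs_mul, abs_mul, abs_of_pos hc, abs_of_nonneg hs] at habs
    exact le_of_mul_le_mul_right habs hdi
  refine ⟨g, ⟨hg, hAg, fun h hne hA hconf => ?_⟩, ⌊c⁻¹⌋₊, ?_, ?_⟩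
  · obtain ⟨s, hs, -, hh⟩ := hline' h hne hA (hconf.trans hgd)
    have hcs : c ≤ s := hle h hne hA (hconf.trans hgd) s hs.le hh
    have habs : |(h i : ℝ)| ≤ |(g i : ℝ)| := by exact_mod_cast (hconf i).2
    rw [hcg, hh, abs_mul, abs_mul, abs_of_pos hc, abs_of_pos hs] at habs
    have hsc : s = c := le_antisymm (le_of_mul_le_mul_right habs hdi) hcs
    funext j
    have : (h j : ℝ) = g j := by rw [hh, hcg, hsc]
    exact_mod_cast this
  · exact Nat.floor_pos.mpr ((one_le_inv₀ hc).mpr hc₁)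
  · set k := ⌊c⁻¹⌋₊ with hk
    have hk₁ : (k : ℝ) * c ≤ 1 := by
      have := mul_le_mul_of_nonneg_right (Nat.floor_le (inv_pos.mpr hc).le) hc.le
      rwa [inv_mul_cancel₀ hc.ne'] at this
    have hk₂ : 1 < ((k : ℝ) + 1) * c := by
      have := mul_lt_mul_of_pos_right (Nat.lt_floor_add_one c⁻¹) hc
      rwa [inv_mul_cancel₀ hc.ne'] at this
    have hr : ∀ j, (((d - (k : ℤ) • g) j : ℤ) : ℝ) = (1 - k * c) * d j := by
      intro j
      simp only [Pi.sub_apply, Pi.smul_apply, smul_eq_mul]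
      push_cast
      rw [hcg]
      ring
    have hkc : 0 ≤ (k : ℝ) * c := by positivity
    by_contra hne
    have := hle (d - (k : ℤ) • g) (sub_ne_zero.mpr hne)
      (by rw [Matrix.mulVec_sub, Matrix.mulVec_smul, hAd, hAg, smul_zero, sub_zero])
      (conformalTo_of_eq_mul (by linarith) (by linarith) hr) _ (by linarith) hr
    linarith

theorem ConformalTo.le_and_neg_le_of_nonneg {n : ℕ} {h u v : Fin n → ℤ} (hu : 0 ≤ u) (hv : 0 ≤ v)
    (hconf : ConformalTo h (u - v)) : h ≤ u ∧ -h ≤ v := by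
  refine ⟨fun i => ?_, fun i => ?_⟩ <;>
  · obtain ⟨h₁, h₂⟩ := hconf i
    have hui := hu i
    have hvi := hv i
    simp only [Pi.sub_apply, Pi.zero_apply, Pi.neg_apply] at *
    rcases lt_trichotomy (u i - v i) 0 with hlt | heq | hgt
    · have : h i ≤ 0 := nonpos_of_mul_nonneg_left h₁ hlt
      rw [abs_of_nonpos this, abs_of_neg hlt] at h₂
      omega
    · rw [heq, abs_zero, abs_nonpos_iff] at h₂
      omega
    · have : 0 ≤ h i := nonneg_of_mul_nonneg_left h₁ hgt
      rw [abs_of_nonneg this, abs_of_pos hgt] at h₂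
      omega

/-- If the set of maximizers of `w` over `P = conv {x ∈ ℕ^n : Ax = b}` is an edge
(one-dimensional face) `e`, then the difference of any two distinct integer points of `e`
is a positive integer multiple of a single Graver basis element. -/
theorem edge_difference_is_multiple_of_graver_element {m n : ℕ}
    (A : Matrix (Fin m) (Fin n) ℤ) (b : Fin m → ℤ)
    (P : Set (Fin n → ℝ)) (hP : P = convexHull ℝ (feasSet A b))
    (w : Fin n → ℝ) (e : Set (Fin n → ℝ))
    (he : e = {x | x ∈ P ∧ ∀ y ∈ P, w ⬝ᵥ y ≤ w ⬝ᵥ x})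
    (hdim : Module.finrank ℝ ↥(vectorSpan ℝ e) = 1)
    (u v : Fin n → ℤ) (hue : intCast u ∈ e) (hve : intCast v ∈ e) (huv : u ≠ v) :
    ∃ g ∈ GraverBasis A, ∃ k : ℕ, 0 < k ∧ u - v = (k : ℤ) • g := by
  have hmem : ∀ z : Fin n → ℤ, intCast z ∈ P ↔ 0 ≤ z ∧ A.mulVec z = b := by
    intro z
    rw [hP, intCast_mem_convexHull_feasSet_iff]
  have hcast : ∀ x y : Fin n → ℤ, intCast (x - y) = intCast x - intCast y := by
    intro x y
    funext i
    simp [intCast]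
  have hu := hue
  have hv := hve
  rw [he] at hu hv
  obtain ⟨hu₀, hAu⟩ := (hmem u).mp hu.1
  obtain ⟨hv₀, hAv⟩ := (hmem v).mp hv.1
  have hne : (⟨intCast (u - v), by
      rw [hcast]; exact vsub_mem_vectorSpan ℝ hue hve⟩ : vectorSpan ℝ e) ≠ 0 := by
    intro h0
    refine huv (funext fun i => ?_)
    have := congrFun (congrArg Subtype.val h0) i
    simp only [intCast, Pi.sub_apply, ZeroMemClass.coe_zero, Pi.zero_apply, Int.cast_eq_zero]
      at this
    omega
  refine exists_graverBasis_smul_eq (sub_ne_zero.mpr huv)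
    (by rw [Matrix.mulVec_sub, hAu, hAv, sub_self]) fun h hAh hconf => ?_
  obtain ⟨hhu, hhv⟩ := hconf.le_and_neg_le_of_nonneg hu₀ hv₀
  have hsubP : intCast (u - h) ∈ P :=
    (hmem _).mpr ⟨sub_nonneg.mpr hhu, by rw [Matrix.mulVec_sub, hAu, hAh, sub_zero]⟩
  have haddP : intCast (v - -h) ∈ P :=
    (hmem _).mpr ⟨sub_nonneg.mpr hhv, by
      rw [Matrix.mulVec_sub, Matrix.mulVec_neg, hAv, hAh, neg_zero, sub_zero]⟩
  have hwh : w ⬝ᵥ intCast (u - h) = w ⬝ᵥ intCast u := by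
    have hneg : intCast (-h) = -intCast h := by
      funext i
      simp [intCast]
    have h₁ := hu.2 _ hsubP
    have h₂ := hv.2 _ haddP
    rw [hcast, dotProduct_sub] at h₁ h₂ ⊢
    rw [hneg, dotProduct_neg] at h₂
    linarith
  have hsube : intCast (u - h) ∈ e := by
    rw [he]
    exact ⟨hsubP, fun y hy => hwh ▸ hu.2 y hy⟩
  have hspan : intCast h ∈ vectorSpan ℝ e := by
    have := vsub_mem_vectorSpan ℝ hue hsube
    rwa [vsub_eq_sub, ← hcast, sub_sub_cancel] at this
  obtain ⟨c, hc⟩ := (finrank_eq_one_iff_of_nonzero' _ hne).mp hdim ⟨_, hspan⟩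
  refine ⟨c, fun i => ?_⟩
  have := congrFun (congrArg Subtype.val hc) i
  simpa [intCast] using this.symm
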